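/- Fix n ≥ 1 and let H, I, U, V : ℝ → Matrix (Fin n) (Fin n) ℂ be such that for every t ∈ ℝ: U has derivative −i·H(t)·U(t) at t, V has derivative i·V(t)·H(t) at t, I has derivative −i·(H(t)·I(t) − I(t)·H(t)) at t, and U(0) = V(0) = 1, and suppose V(t)·U(t) = 1 = U(t)·V(t) for all t. Then for every t ∈ ℝ, the spectrum of the matrix I(t) equals the spectrum of I(0). -/

import Mathlib

/-- Entrywise derivative of a matrix-valued function of a real variable. -/
def MatrixHasDerivAt {n : ℕ} (F : ℝ → Matrix (Fin n) (Fin n) ℂ)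
    (F' : Matrix (Fin n) (Fin n) ℂ) (t : ℝ) : Prop :=
  ∀ i j, HasDerivAt (fun s => F s i j) (F' i j) t

theorem MatrixHasDerivAt.mul_aux {n : ℕ} {F G : ℝ → Matrix (Fin n) (Fin n) ℂ}
    {F' G' : Matrix (Fin n) (Fin n) ℂ} {t : ℝ}
    (hF : MatrixHasDerivAt F F' t) (hG : MatrixHasDerivAt G G' t) :
    MatrixHasDerivAt (fun s => F s * G s) (F' * G t + F t * G') t := by
  intro i j
  simp only [Matrix.mul_apply, Matrix.add_apply, ← Finset.sum_add_distrib]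
  exact HasDerivAt.fun_sum fun k _ => (hF i k).mul (hG k j)

/-- **Lewis–Riesenfeld: the spectrum of a dynamical invariant is time independent.**
With `U' = −iHU`, `V' = iVH`, `Iv' = −i(H·Iv − Iv·H)`, `U(0) = V(0) = 1`, and
`V(t)U(t) = 1 = U(t)V(t)` for all `t`, the spectrum of `Iv(t)` equals that of `Iv(0)`. -/
theorem invariant_spectrum_constant
    (n : ℕ) (hn : 1 ≤ n)
    (H Iv U V : ℝ → Matrix (Fin n) (Fin n) ℂ)
    (hU : ∀ t : ℝ, MatrixHasDerivAt U ((-Complex.I) • (H t * U t)) t)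
    (hV : ∀ t : ℝ, MatrixHasDerivAt V (Complex.I • (V t * H t)) t)
    (hI : ∀ t : ℝ, MatrixHasDerivAt Iv ((-Complex.I) • (H t * Iv t - Iv t * H t)) t)
    (hU0 : U 0 = 1) (hV0 : V 0 = 1)
    (hVU : ∀ t : ℝ, V t * U t = 1) (hUV : ∀ t : ℝ, U t * V t = 1) :
    ∀ t : ℝ, spectrum ℂ (Iv t) = spectrum ℂ (Iv 0) := by
  intro t
  have hd : ∀ s, MatrixHasDerivAt (fun s => V s * Iv s * U s) 0 s := by
    intro s
    have h := ((hV s).mul_aux (hI s)).mul_aux (hU s)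
    convert h using 1
    simp only [smul_mul_assoc, mul_smul_comm, neg_smul, mul_sub, sub_mul, add_mul, mul_add,
      smul_sub, smul_add, mul_neg, neg_mul, mul_assoc]
    abel
  have hc : V t * Iv t * U t = Iv 0 := by
    have h0 : V t * Iv t * U t = V 0 * Iv 0 * U 0 := by
      ext i j
      exact is_const_of_deriv_eq_zero (f := fun s => (V s * Iv s * U s) i j)
        (fun s => (hd s i j).differentiableAt) (fun s => (hd s i j).deriv) t 0
    rw [h0, hU0, hV0, one_mul, mul_one]
  let u : (Matrix (Fin n) (Fin n) ℂ)ˣ := ⟨U t, V t, hUV t, hVU t⟩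
  rw [← hc]
  exact (spectrum.units_conjugate' (R := ℂ) (a := Iv t) (u := u)).symm
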